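/- Fix k ≥ 1. Let A = {a, b_0, b_1, …, b_k}, let φ be the morphism with φ(a) = a b_k, φ(b_0) = b_0, and φ(b_i) = b_i b_{i−1} for 1 ≤ i ≤ k, and let ψ be the coding with ψ(a) = 0, ψ(b_i) = 0 for 0 ≤ i ≤ k−1, and ψ(b_k) = 1. Then the morphic sequence α = ψ(φ^∞(a)) over {0,1} satisfies P_α(n) = Θ(n^{1+1/k}). -/

import Mathlib

open Filter Asymptotics

variable {A : Type*}

/-- Extension of a morphism, given on letters, to words. -/
def wordMap (φ : A → List A) (w : List A) : List A := w.flatMap φ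

/-- The factor of the infinite word α of length n starting at position i. -/
def factorAt (α : ℕ → A) (i n : ℕ) : List A := (List.range n).map (fun j => α (i + j))

/-- w is a factor (contiguous subword) of the infinite word α. -/
def IsFactor (α : ℕ → A) (w : List A) : Prop := ∃ i, w = factorAt α i w.length

/-- The factor complexity of α: the number of distinct factors of length n. -/
noncomputable def complexity (α : ℕ → A) (n : ℕ) : ℕ :=
  Set.ncard {w : List A | w.length = n ∧ IsFactor α w}

def UltimatelyPeriodic (α : ℕ → A) : Prop :=
  ∃ N p : ℕ, 1 ≤ p ∧ ∀ i, N ≤ i → α (i + p) = α i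

/-- φ is prolongable on a: φ(a) = a·w with w nonempty and |φ^n(a)| → ∞. -/
def Prolongable (φ : A → List A) (a : A) : Prop :=
  (∃ w, w ≠ [] ∧ φ a = a :: w) ∧
    Tendsto (fun n => ((wordMap φ)^[n] [a]).length) atTop atTop

/-- α is the pure morphic sequence φ^∞(a): every iterate φ^n(a) is a prefix of α. -/
def IsFixedSeq (φ : A → List A) (a : A) (α : ℕ → A) : Prop :=
  ∀ n, factorAt α 0 ((wordMap φ)^[n] [a]).length = (wordMap φ)^[n] [a]

/-- The letter b is growing for φ: |φ^k(b)| → ∞. -/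
def GrowingLetter (φ : A → List A) (b : A) : Prop :=
  Tendsto (fun k => ((wordMap φ)^[k] [b]).length) atTop atTop

def BoundedLetter (φ : A → List A) (b : A) : Prop := ¬ GrowingLetter φ b

/-- φ is growing: every letter is growing. -/
def Growing (φ : A → List A) : Prop := ∀ b, GrowingLetter φ b

/-- The morphism on A = {b₀, …, bₖ, a} (with bᵢ = i and a = k+1):
φ(a) = a bₖ, φ(b₀) = b₀, φ(bᵢ) = bᵢ bᵢ₋₁. -/
def phi5 (k : ℕ) : Fin (k + 2) → List (Fin (k + 2)) := fun c =>
  if (c : ℕ) = k + 1 then [⟨k + 1, by omega⟩, ⟨k, by omega⟩]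
  else if (c : ℕ) = 0 then [c]
  else [c, ⟨(c : ℕ) - 1, by have := c.isLt; omega⟩]

/-- The coding ψ(a) = 0, ψ(bᵢ) = 0 for i < k, ψ(bₖ) = 1. -/
def psi5 (k : ℕ) : Fin (k + 2) → Fin 2 := fun c => if (c : ℕ) = k then 1 else 0

/-- Length of the `n`-th iterate of `phi5` on the letter of index `c`. -/
def iterLength : ℕ → ℕ → ℕ
  | 0, _ => 1
  | c + 1, n => 1 + ∑ j ∈ Finset.range n, iterLength c j

theorem iterLength_zero_right (c : ℕ) : iterLength c 0 = 1 := by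
  cases c <;> simp [iterLength]

theorem iterLength_succ_succ (c n : ℕ) :
    iterLength (c + 1) (n + 1) = iterLength (c + 1) n + iterLength c n := by
  simp [iterLength, Finset.sum_range_succ, add_assoc]

theorem iterLength_pos (c n : ℕ) : 0 < iterLength c n := by
  cases c <;> simp [iterLength]

theorem iterLength_succ_strictMono (c : ℕ) : StrictMono (iterLength (c + 1)) :=
  strictMono_nat_of_lt_succ fun n => by
    rw [iterLength_succ_succ]
    exact Nat.lt_add_of_pos_right (iterLength_pos c n)

theorem iterLength_monotone (c : ℕ) : Monotone (iterLength c) := by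
  cases c with
  | zero => exact fun _ _ _ => by simp [iterLength]
  | succ c => exact (iterLength_succ_strictMono c).monotone

theorem iterLength_le_pow (c n : ℕ) : iterLength c n ≤ (n + 1) ^ c := by
  induction c generalizing n with
  | zero => simp [iterLength]
  | succ c ih =>
    have hsum : ∑ j ∈ Finset.range n, iterLength c j ≤ n * (n + 1) ^ c := by
      have h : ∀ j ∈ Finset.range n, iterLength c j ≤ (n + 1) ^ c := fun j hj =>
        (ih j).trans (Nat.pow_le_pow_left (by have := Finset.mem_range.1 hj; omega) c)
      simpa using Finset.sum_le_card_nsmul _ _ _ h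
    have hone : 1 ≤ (n + 1) ^ c := Nat.one_le_pow _ _ (by omega)
    rw [iterLength, pow_succ]
    linarith

theorem pow_le_iterLength_mul (c n : ℕ) : n ^ c ≤ iterLength c (c * n) := by
  induction c with
  | zero => simp [iterLength]
  | succ c ih =>
    have hsum : ∑ _j ∈ Finset.range n, n ^ c ≤
        ∑ j ∈ Finset.range n, iterLength c (c * n + j) :=
      Finset.sum_le_sum fun j _ => ih.trans (iterLength_monotone c (by omega))
    rw [iterLength, add_mul, one_mul, Finset.sum_range_add]
    simp only [Finset.sum_const, Finset.card_range, smul_eq_mul] at hsum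
    rw [pow_succ']
    exact hsum.trans (by omega)

theorem wordMap_append {A : Type*} (φ : A → List A) (u v : List A) :
    wordMap φ (u ++ v) = wordMap φ u ++ wordMap φ v := by
  simp [wordMap]

theorem wordMap_iterate_append {A : Type*} (φ : A → List A) (n : ℕ) (u v : List A) :
    (wordMap φ)^[n] (u ++ v) = (wordMap φ)^[n] u ++ (wordMap φ)^[n] v := by
  induction n generalizing u v with
  | zero => rfl
  | succ n ih => simp only [Function.iterate_succ_apply, wordMap_append, ih]

theorem wordMap_phi5_zero (k : ℕ) (h : 0 < k + 2) :
    wordMap (phi5 k) [⟨0, h⟩] = [⟨0, h⟩] := by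
  simp [wordMap, phi5]

theorem wordMap_phi5_succ (k c : ℕ) (h : c + 1 < k + 2) :
    wordMap (phi5 k) [⟨c + 1, h⟩] = [⟨c + 1, h⟩] ++ [⟨c, by omega⟩] := by
  by_cases hc : c = k
  · subst hc; simp [wordMap, phi5]
  · simp [wordMap, phi5, hc]

theorem phi5_iterate_succ (k c n : ℕ) (h : c + 1 < k + 2) :
    (wordMap (phi5 k))^[n + 1] [⟨c + 1, h⟩] =
      (wordMap (phi5 k))^[n] [⟨c + 1, h⟩] ++ (wordMap (phi5 k))^[n] [⟨c, by omega⟩] := by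
  rw [Function.iterate_succ_apply, wordMap_phi5_succ, wordMap_iterate_append]

theorem length_phi5_iterate (k c n : ℕ) (h : c < k + 2) :
    ((wordMap (phi5 k))^[n] [⟨c, h⟩]).length = iterLength c n := by
  induction n generalizing c with
  | zero => simp [iterLength_zero_right]
  | succ n ih =>
    cases c with
    | zero => rw [Function.iterate_succ_apply, wordMap_phi5_zero, ih]; rfl
    | succ c => rw [phi5_iterate_succ, List.length_append, ih, ih, iterLength_succ_succ]

/-- Apart from its first letter, an iterate of `phi5` on a letter has only letters of
smaller index. -/
theorem phi5_iterate_eq_cons (k c n : ℕ) (h : c < k + 2) :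
    ∃ t : List (Fin (k + 2)), (wordMap (phi5 k))^[n] [⟨c, h⟩] = ⟨c, h⟩ :: t ∧
      ∀ x ∈ t, (x : ℕ) < c := by
  induction n generalizing c with
  | zero => exact ⟨[], rfl, by simp⟩
  | succ n ih =>
    cases c with
    | zero => rw [Function.iterate_succ_apply, wordMap_phi5_zero]; exact ih 0 h
    | succ c =>
      obtain ⟨t, ht, htc⟩ := ih (c + 1) h
      obtain ⟨u, hu, huc⟩ := ih c (by omega)
      refine ⟨t ++ ⟨c, by omega⟩ :: u, ?_, ?_⟩
      · rw [phi5_iterate_succ, ht, hu]; rfl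
      · intro x hx
        rcases List.mem_append.1 hx with hx | hx
        · exact htc x hx
        · rcases List.mem_cons.1 hx with rfl | hx
          · simp
          · exact (huc x hx).trans (by omega)

theorem length_factorAt {A : Type*} (α : ℕ → A) (i n : ℕ) : (factorAt α i n).length = n := by
  simp [factorAt]

theorem factorAt_eq_iff {A : Type*} (α : ℕ → A) (i i' n : ℕ) :
    factorAt α i n = factorAt α i' n ↔ ∀ j < n, α (i + j) = α (i' + j) := by
  simp [factorAt]

theorem factorAt_add {A : Type*} (α : ℕ → A) (i m n : ℕ) :
    factorAt α i (m + n) = factorAt α i m ++ factorAt α (i + m) n := by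
  simp [factorAt, List.range_add, Function.comp_def, add_assoc]

theorem setOf_factors_eq_range {A : Type*} (α : ℕ → A) (n : ℕ) :
    {w : List A | w.length = n ∧ IsFactor α w} = Set.range fun i => factorAt α i n := by
  ext w
  constructor
  · rintro ⟨rfl, i, hi⟩
    exact ⟨i, hi.symm⟩
  · rintro ⟨i, rfl⟩
    exact ⟨length_factorAt α i n, i, by rw [length_factorAt]⟩

theorem setOf_factors_finite {A : Type*} [Finite A] (α : ℕ → A) (n : ℕ) :
    {w : List A | w.length = n ∧ IsFactor α w}.Finite :=
  (List.finite_length_eq A n).subset fun _ hw => hw.1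

/-- The fixed point of `phi5` is the concatenation of `a` and the iterates on `b_k`. -/
theorem factorAt_fixedSeq (k n : ℕ) (α : ℕ → Fin (k + 2))
    (hfix : IsFixedSeq (phi5 k) ⟨k + 1, by omega⟩ α) :
    factorAt α (iterLength (k + 1) n) (iterLength k n) =
      (wordMap (phi5 k))^[n] [⟨k, by omega⟩] := by
  have h := hfix (n + 1)
  have h' := hfix n
  rw [length_phi5_iterate] at h h'
  rw [phi5_iterate_succ, iterLength_succ_succ, factorAt_add, h', zero_add] at h
  exact List.append_cancel_left h

theorem psi5_fixedSeq_eq_one_iff (k : ℕ) (α : ℕ → Fin (k + 2))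
    (hfix : IsFixedSeq (phi5 k) ⟨k + 1, by omega⟩ α) (i : ℕ) :
    psi5 k (α i) = 1 ↔ ∃ n, iterLength (k + 1) n = i := by
  have hpsi (c : Fin (k + 2)) : psi5 k c = 1 ↔ (c : ℕ) = k := by
    unfold psi5; split_ifs with h <;> simp [h]
  have hblock (n j : ℕ) (hj : j < iterLength k n) :
      (α (iterLength (k + 1) n + j) : ℕ) = k ↔ j = 0 := by
    obtain ⟨t, ht, htk⟩ := phi5_iterate_eq_cons k k n (by omega)
    have hget : (factorAt α (iterLength (k + 1) n) (iterLength k n))[j]? =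
        some (α (iterLength (k + 1) n + j)) := by simp [factorAt, hj]
    rw [factorAt_fixedSeq k n α hfix, ht] at hget
    cases j with
    | zero =>
      simp only [List.getElem?_cons_zero, Option.some.injEq] at hget
      rw [← hget]
      simp
    | succ j =>
      rw [List.getElem?_cons_succ] at hget
      have := htk _ (List.mem_of_getElem? hget)
      constructor <;> intro <;> omega
  rw [hpsi]
  constructor
  · intro hi
    have hexists : ∃ n, i < iterLength (k + 1) n :=
      ⟨i + 1, (iterLength_succ_strictMono k).le_apply⟩
    classical
    cases hn : Nat.find hexists with
    | zero =>
      have hlt := Nat.find_spec hexists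
      rw [hn, iterLength_zero_right] at hlt
      have hzero := hfix 0
      obtain rfl : i = 0 := by omega
      simp [factorAt] at hzero
      simp [hzero] at hi
    | succ n =>
      have hlt := Nat.find_spec hexists
      have hle := Nat.find_min hexists (m := n) (by omega)
      rw [hn, iterLength_succ_succ] at hlt
      rw [not_lt] at hle
      obtain ⟨j, rfl⟩ := Nat.exists_eq_add_of_le hle
      have := (hblock n j (by omega)).1 hi
      exact ⟨n, by omega⟩
  · rintro ⟨n, rfl⟩
    exact (hblock n 0 (iterLength_pos k n)).2 rfl

theorem fin_two_eq_of_eq_one_iff {x y : Fin 2} (h : x = 1 ↔ y = 1) : x = y := by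
  omega

/-- If from the `m`-th occurrence on consecutive ones are at distance at least `N`, then only
the factors starting before that occurrence can contain more than one letter `1`. -/
theorem complexity_le_of_gaps {β : ℕ → Fin 2} {s : ℕ → ℕ}
    (hβ : ∀ i, β i = 1 ↔ ∃ n, s n = i) (hs : StrictMono s) {m N : ℕ}
    (hgap : ∀ n, m ≤ n → s n + N ≤ s (n + 1)) :
    complexity β N ≤ s m + (N + 1) := by
  classical
  let single : ℕ → List (Fin 2) := fun r => (List.range N).map fun j => if j = r then 1 else 0
  let T : Finset (List (Fin 2)) :=
    (Finset.range (s m)).image (fun i => factorAt β i N) ∪ (Finset.range (N + 1)).image single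
  have hsub : {w : List (Fin 2) | w.length = N ∧ IsFactor β w} ⊆ (T : Set (List (Fin 2))) := by
    rw [setOf_factors_eq_range]
    rintro _ ⟨i, rfl⟩
    simp only [T, Finset.coe_union, Finset.coe_image, Finset.coe_range]
    by_cases hi : i < s m
    · exact Or.inl ⟨i, hi, rfl⟩
    right
    have huniq : ∀ j < N, ∀ l < N, β (i + j) = 1 → β (i + l) = 1 → j ≤ l := by
      intro j hj l hl h1 h2
      obtain ⟨p, hp⟩ := (hβ _).1 h1
      obtain ⟨q, hq⟩ := (hβ _).1 h2
      by_contra! hlt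
      have hqp : q + 1 ≤ p := hs.lt_iff_lt.1 (by omega)
      have hmq : m ≤ q := hs.le_iff_le.1 (by omega)
      have := hgap q hmq
      have := hs.monotone hqp
      omega
    by_cases hone : ∃ r < N, β (i + r) = 1
    · obtain ⟨r, hr, hr1⟩ := hone
      refine ⟨r, Set.mem_Iio.2 (by omega), ?_⟩
      refine List.map_congr_left fun j hj => fin_two_eq_of_eq_one_iff ?_
      have hj := List.mem_range.1 hj
      constructor
      · intro h
        have hjr : j = r := by by_contra hne; simp [hne] at h
        rwa [hjr]
      · intro h
        simp [le_antisymm (huniq j hj r hr h hr1) (huniq r hr j hj hr1 h)]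
    · push Not at hone
      refine ⟨N, Set.mem_Iio.2 (by omega), ?_⟩
      refine List.map_congr_left fun j hj => fin_two_eq_of_eq_one_iff ?_
      have hj := List.mem_range.1 hj
      simp [hone j hj, hj.ne]
  calc complexity β N ≤ (T : Set (List (Fin 2))).ncard :=
        Set.ncard_le_ncard hsub T.finite_toSet
    _ = T.card := Set.ncard_coe_finset T
    _ ≤ s m + (N + 1) := (Finset.card_union_le _ _).trans
        (add_le_add (Finset.card_image_le.trans (by simp)) (Finset.card_image_le.trans (by simp)))

/-- If the distances between consecutive ones are distinct and at most `D` up to the `m`-th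
occurrence, then the factors of length `N > 2 * D` starting before it are distinct. -/
theorem le_complexity_of_gaps {β : ℕ → Fin 2} {s : ℕ → ℕ}
    (hβ : ∀ i, β i = 1 ↔ ∃ n, s n = i) (hs : StrictMono s)
    (hinj : Function.Injective fun n => s (n + 1) - s n) {m N D : ℕ} (hD0 : s 0 ≤ D)
    (hD : ∀ n ≤ m, s (n + 1) ≤ s n + D) (hN : 2 * D < N) :
    s m ≤ complexity β N := by
  classical
  have hfirst : ∀ p < s m, ∃ n, p ≤ s n ∧ s (n + 1) < p + N ∧ ∀ l, p ≤ s l → n ≤ l := by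
    intro p hp
    have hex : ∃ n, p ≤ s n := ⟨m, hp.le⟩
    refine ⟨Nat.find hex, Nat.find_spec hex, ?_, fun l hl => Nat.find_min' hex hl⟩
    have hle : Nat.find hex ≤ m := Nat.find_min' hex hp.le
    have h1 := hD _ hle
    cases hn : Nat.find hex with
    | zero => rw [hn] at h1; omega
    | succ n =>
      rw [hn] at h1 hle
      have h2 := hD n (by omega)
      have h3 := Nat.find_min hex (m := n) (by omega)
      omega
  -- one-sided comparison of the first two ones of two equal factors
  have hcompare : ∀ p q n l : ℕ, (∀ j < N, β (p + j) = β (q + j)) →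
      p ≤ s n → s (n + 1) < p + N → (∀ l', q ≤ s l' → l ≤ l') →
      s l + p ≤ s n + q ∧ s (l + 1) + p ≤ s (n + 1) + q := by
    intro p q n l heq hpn hnN hl
    have hlt : s n < s (n + 1) := hs (Nat.lt_succ_self n)
    have hocc : ∀ x, p ≤ s x → s x < p + N → ∃ y, s y = q + (s x - p) := by
      intro x h1 h2
      have h3 := heq (s x - p) (by omega)
      rw [Nat.add_sub_cancel' h1, (hβ (s x)).2 ⟨x, rfl⟩] at h3
      exact (hβ _).1 h3.symm
    obtain ⟨y, hy⟩ := hocc n hpn (by omega)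
    obtain ⟨z, hz⟩ := hocc (n + 1) (by omega) hnN
    have hly := hl y (by omega)
    have hyz : y < z := hs.lt_iff_lt.1 (by omega)
    have h1 := hs.monotone hly
    have h2 := hs.monotone (show l + 1 ≤ z by omega)
    constructor <;> omega
  have hinjOn : Set.InjOn (fun i => factorAt β i N) (Finset.range (s m)) := by
    intro p hp q hq hpq
    rw [factorAt_eq_iff] at hpq
    obtain ⟨n, hn1, hn2, hn3⟩ := hfirst p (by simpa using hp)
    obtain ⟨l, hl1, hl2, hl3⟩ := hfirst q (by simpa using hq)
    obtain ⟨h1, h2⟩ := hcompare p q n l hpq hn1 hn2 hl3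
    obtain ⟨h3, h4⟩ := hcompare q p l n (fun j hj => (hpq j hj).symm) hl1 hl2 hn3
    have hnl : n = l := hinj (show s (n + 1) - s n = s (l + 1) - s l by omega)
    subst hnl
    omega
  calc s m = ((Finset.range (s m)).image fun i => factorAt β i N).card := by
        rw [Finset.card_image_of_injOn hinjOn, Finset.card_range]
    _ = (((Finset.range (s m)).image fun i => factorAt β i N : Finset (List (Fin 2))) :
          Set (List (Fin 2))).ncard := (Set.ncard_coe_finset _).symm
    _ ≤ complexity β N := by
        refine Set.ncard_le_ncard ?_ (setOf_factors_finite β N)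
        rw [setOf_factors_eq_range, Finset.coe_image]
        exact Set.image_subset_range _ _

section PansiotBounds

variable {k : ℕ} {α : ℕ → Fin (k + 2)}

theorem complexity_le_of_le_iterLength (hfix : IsFixedSeq (phi5 k) ⟨k + 1, by omega⟩ α)
    {m N : ℕ} (hm : N ≤ iterLength k m) :
    complexity (fun i => psi5 k (α i)) N ≤ iterLength (k + 1) m + (N + 1) := by
  refine complexity_le_of_gaps (psi5_fixedSeq_eq_one_iff k α hfix)
    (iterLength_succ_strictMono k) fun n hn => ?_
  rw [iterLength_succ_succ]
  have := iterLength_monotone k hn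
  omega

theorem iterLength_le_complexity (hk : 1 ≤ k)
    (hfix : IsFixedSeq (phi5 k) ⟨k + 1, by omega⟩ α) {m N : ℕ} (hm : 2 * iterLength k m < N) :
    iterLength (k + 1) m ≤ complexity (fun i => psi5 k (α i)) N := by
  refine le_complexity_of_gaps (psi5_fixedSeq_eq_one_iff k α hfix)
    (iterLength_succ_strictMono k) ?_ (D := iterLength k m) ?_ (fun n hn => ?_) hm
  · obtain ⟨c, rfl⟩ := Nat.exists_eq_add_of_le' hk
    simpa only [iterLength_succ_succ, Nat.add_sub_cancel_left] using
      (iterLength_succ_strictMono c).injective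
  · rw [iterLength_zero_right]
    exact iterLength_pos k m
  · rw [iterLength_succ_succ]
    exact Nat.add_le_add_left (iterLength_monotone k hn) _

end PansiotBounds

theorem rpow_one_add_one_div {k : ℕ} (hk : 1 ≤ k) {x N : ℝ} (hx : 0 ≤ x) (hxN : x ^ k = N) :
    N ^ ((1 : ℝ) + 1 / k) = x ^ (k + 1) := by
  have hk0 : (k : ℝ) ≠ 0 := by positivity
  rw [← hxN, ← Real.rpow_natCast, ← Real.rpow_natCast, ← Real.rpow_mul hx]
  congr 1
  push_cast
  field_simp

/-- The morphic sequence ψ(φ^∞(a)) has complexity Θ(n^(1+1/k)). -/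
theorem pansiot_example (k : ℕ) (hk : 1 ≤ k) (α : ℕ → Fin (k + 2))
    (hfix : IsFixedSeq (phi5 k) ⟨k + 1, by omega⟩ α) :
    (fun n => (complexity (fun i => psi5 k (α i)) n : ℝ)) =Θ[atTop]
      (fun n => (n : ℝ) ^ ((1 : ℝ) + 1 / k)) := by
  have hk0 : k ≠ 0 := by omega
  have hroot (N : ℕ) : ((N : ℝ) ^ ((1 : ℝ) / k)) ^ k = N := by
    rw [one_div]; exact Real.rpow_inv_natCast_pow (Nat.cast_nonneg N) hk0
  constructor
  · refine IsBigO.of_bound ((2 * (k + 1)) ^ (k + 1) + 2) ?_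
    filter_upwards [eventually_ge_atTop 1] with N hN
    set x : ℝ := (N : ℝ) ^ ((1 : ℝ) / k)
    have hN1 : (1 : ℝ) ≤ N := by exact_mod_cast hN
    have hx1 : 1 ≤ x := Real.one_le_rpow hN1 (by positivity)
    have hxN : x ^ k = N := hroot N
    rw [rpow_one_add_one_div hk (by linarith) hxN, Real.norm_of_nonneg (by positivity),
      Real.norm_of_nonneg (by positivity)]
    have hceil : (⌈x⌉₊ : ℝ) ≤ 2 * x := by
      linarith [Nat.ceil_lt_add_one (show 0 ≤ x by linarith)]
    have hm : N ≤ iterLength k (k * ⌈x⌉₊) := by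
      refine le_trans ?_ (pow_le_iterLength_mul k _)
      have : x ^ k ≤ (⌈x⌉₊ : ℝ) ^ k := pow_le_pow_left₀ (by linarith) (Nat.le_ceil x) k
      rw [hxN] at this
      exact_mod_cast this
    have hbound : (complexity (fun i => psi5 k (α i)) N : ℝ) ≤
        (k * (⌈x⌉₊ : ℝ) + 1) ^ (k + 1) + (N + 1) := by
      exact_mod_cast (complexity_le_of_le_iterLength hfix hm).trans
        (Nat.add_le_add_right (iterLength_le_pow (k + 1) _) _)
    have hpow : (k * (⌈x⌉₊ : ℝ) + 1) ^ (k + 1) ≤ (2 * (k + 1)) ^ (k + 1) * x ^ (k + 1) := by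
      rw [← mul_pow]
      refine pow_le_pow_left₀ (by positivity) ?_ _
      have := mul_le_mul_of_nonneg_left hceil (Nat.cast_nonneg (α := ℝ) k)
      linarith
    have hNx : (N : ℝ) ≤ x ^ (k + 1) := by
      rw [← hxN]
      exact pow_le_pow_right₀ hx1 (Nat.le_succ k)
    linarith
  · refine IsBigO.of_bound ((8 * (k + 1)) ^ (k + 1)) ?_
    have htend : Tendsto (fun N : ℕ => (N : ℝ) ^ ((1 : ℝ) / k)) atTop atTop :=
      (tendsto_rpow_atTop (by positivity)).comp tendsto_natCast_atTop_atTop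
    filter_upwards [htend.eventually_gt_atTop (4 * (k + 1))] with N hNx
    set x : ℝ := (N : ℝ) ^ ((1 : ℝ) / k)
    have hxN : x ^ k = N := hroot N
    have hkpos : (0 : ℝ) < k + 1 := by positivity
    have hx4 : 4 < x := by linarith [Nat.cast_nonneg (α := ℝ) k]
    rw [rpow_one_add_one_div hk (by linarith) hxN, Real.norm_of_nonneg (by positivity),
      Real.norm_of_nonneg (by positivity)]
    set z : ℝ := x / (4 * (k + 1)) with hz
    have hz1 : 1 ≤ z := by rw [hz, le_div_iff₀ (by positivity)]; linarith
    have hxz : x = 4 * (k + 1) * z := by rw [hz]; field_simp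
    have hfloor_le : (⌊z⌋₊ : ℝ) ≤ z := Nat.floor_le (by linarith)
    have hle_floor : z ≤ 2 * (⌊z⌋₊ : ℝ) := by
      have h1 := Nat.lt_floor_add_one z
      have h2 : (1 : ℝ) ≤ ⌊z⌋₊ := by exact_mod_cast Nat.le_floor (by simpa using hz1)
      linarith
    have hm : 2 * iterLength k ((k + 1) * ⌊z⌋₊) < N := by
      have h1 : (iterLength k ((k + 1) * ⌊z⌋₊) : ℝ) ≤ ((k + 1) * (⌊z⌋₊ : ℝ) + 1) ^ k := by
        exact_mod_cast iterLength_le_pow k _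
      have h2 : ((k + 1) * (⌊z⌋₊ : ℝ) + 1) ^ k < (x / 2) ^ k := by
        refine pow_lt_pow_left₀ ?_ (by positivity) hk0
        have := mul_le_mul_of_nonneg_left hfloor_le hkpos.le
        linarith
      have h3 : 2 * (x / 2) ^ k ≤ N := by
        have h4 : (2 : ℝ) ≤ 2 ^ k := le_self_pow₀ (by norm_num) hk0
        rw [div_pow, hxN, mul_div_assoc', div_le_iff₀ (by positivity), mul_comm]
        exact mul_le_mul_of_nonneg_left h4 (Nat.cast_nonneg N)
      have h5 : (2 : ℝ) * iterLength k ((k + 1) * ⌊z⌋₊) < N := by linarith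
      exact_mod_cast h5
    have hbound : (⌊z⌋₊ : ℝ) ^ (k + 1) ≤ complexity (fun i => psi5 k (α i)) N := by
      exact_mod_cast (pow_le_iterLength_mul (k + 1) ⌊z⌋₊).trans
        (iterLength_le_complexity hk hfix hm)
    calc x ^ (k + 1) ≤ (8 * (k + 1) * (⌊z⌋₊ : ℝ)) ^ (k + 1) := by
          refine pow_le_pow_left₀ (by linarith) ?_ _
          have := mul_le_mul_of_nonneg_left hle_floor hkpos.le
          linarith
      _ = (8 * (k + 1)) ^ (k + 1) * (⌊z⌋₊ : ℝ) ^ (k + 1) := mul_pow _ _ _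
      _ ≤ _ := mul_le_mul_of_nonneg_left hbound (by positivity)
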